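/- arXiv:1703.03203 — 2 statements merged into one kernel-verified Lean document; each statement's English description precedes it below -/
import Mathlib

section
/- Let N ∈ ℕ and let F₁ : [-1, 1] → ℝ be a function that can be represented as F₁(x) = c₁(1-x)^{1/2} + c₂(1-x)^{3/2} + F̃₁(x), where c₁, c₂ ∈ ℝ and F̃₁ is twice continuously differentiable on [-1, 1]. Then there exists a constant L₁ > 0 (depending on F₁ and N) such that for all n ≥ N, |Rₙ| ≤ L₁ / n^{3/2}. -/
open MeasureTheory Set

/-- Integral of a half-integer power over one step. -/
lemma aux_integral_rpow (r u v : ℝ) (hr : 0 ≤ r) :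
    ∫ x in u..v, (1 - x) ^ r = ((1 - u) ^ (r + 1) - (1 - v) ^ (r + 1)) / (r + 1) := by
  rw [intervalIntegral.integral_comp_sub_left (fun x : ℝ => x ^ r) 1, integral_rpow]
  left; linarith

lemma aux_rpow_half {x : ℝ} (hx : 0 ≤ x) (m : ℕ) : x ^ ((m : ℝ) / 2) = (√x) ^ m := by
  rw [Real.sqrt_eq_rpow, ← Real.rpow_natCast, ← Real.rpow_mul hx]
  congr 1; ring

lemma aux_err_half (u v : ℝ) (hu : u ≤ 1) (hv : v ≤ 1) :
    trapezoidal_error (fun x : ℝ => (1 - x) ^ ((1 : ℝ) / 2)) 1 u v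
      = (√(1 - v) - √(1 - u)) ^ 3 / 6 := by
  have e1 : (1 : ℝ) / 2 + 1 = ((3 : ℕ) : ℝ) / 2 := by norm_num
  have e2 : (1 : ℝ) / 2 = ((1 : ℕ) : ℝ) / 2 := by norm_num
  rw [trapezoidal_error, trapezoidal_integral_one, aux_integral_rpow _ _ _ (by norm_num), e1,
    aux_rpow_half (sub_nonneg.2 hu), aux_rpow_half (sub_nonneg.2 hv), e2]
  simp only [aux_rpow_half (sub_nonneg.2 hu), aux_rpow_half (sub_nonneg.2 hv)]
  have h1 := Real.sq_sqrt (sub_nonneg.2 hu)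
  have h2 := Real.sq_sqrt (sub_nonneg.2 hv)
  have h3 : v - u = √(1 - u) ^ 2 - √(1 - v) ^ 2 := by rw [h1, h2]; ring
  rw [h3]; push_cast; ring

lemma aux_err_three_half (u v : ℝ) (hu : u ≤ 1) (hv : v ≤ 1) :
    trapezoidal_error (fun x : ℝ => (1 - x) ^ ((3 : ℝ) / 2)) 1 u v
      = -((√(1 - v) - √(1 - u)) ^ 3 *
        (√(1 - u) ^ 2 + 3 * √(1 - u) * √(1 - v) + √(1 - v) ^ 2) / 10) := by
  have e1 : (3 : ℝ) / 2 + 1 = ((5 : ℕ) : ℝ) / 2 := by norm_num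
  have e2 : (3 : ℝ) / 2 = ((3 : ℕ) : ℝ) / 2 := by norm_num
  rw [trapezoidal_error, trapezoidal_integral_one, aux_integral_rpow _ _ _ (by norm_num), e1,
    aux_rpow_half (sub_nonneg.2 hu), aux_rpow_half (sub_nonneg.2 hv), e2]
  simp only [aux_rpow_half (sub_nonneg.2 hu), aux_rpow_half (sub_nonneg.2 hv)]
  have h1 := Real.sq_sqrt (sub_nonneg.2 hu)
  have h2 := Real.sq_sqrt (sub_nonneg.2 hv)
  have h3 : v - u = √(1 - u) ^ 2 - √(1 - v) ^ 2 := by rw [h1, h2]; ring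
  rw [h3]; push_cast; ring

lemma aux_cont (r : ℝ) (hr : 0 ≤ r) : Continuous (fun x : ℝ => (1 - x) ^ r) :=
  (Real.continuous_rpow_const hr).comp (continuous_const.sub continuous_id)

/-- Errors sum over steps, bounded by a telescoping sum. -/
lemma aux_tele (f : ℝ → ℝ) (hf : Continuous f) (φ : ℝ → ℝ) (n : ℕ) (hn : 0 < n)
    (H : ∀ u v : ℝ, u ≤ 1 → v ≤ 1 → u - v = 1 / n →
      |trapezoidal_error f 1 u v| ≤ φ (1 - v) - φ (1 - u)) :
    |trapezoidal_error f (2 * n) (-1) 1| ≤ φ 2 - φ 0 := by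
  have hn' : (0 : ℝ) < n := by exact_mod_cast hn
  have h2n : 0 < 2 * n := by omega
  have hend : (-1 : ℝ) = 1 + ((2 * n : ℕ) : ℝ) * (-(1 / n)) := by
    push_cast; field_simp; ring
  rw [trapezoidal_error_symm f h2n, abs_neg, hend,
    ← sum_trapezoidal_error_adjacent_intervals h2n (hf.intervalIntegrable _ _)]
  refine (Finset.abs_sum_le_sum_abs _ _).trans ?_
  have hs := Finset.sum_range_sub (fun i : ℕ => φ ((i : ℝ) * (1 / n))) (2 * n)
  have e : (((2 * n : ℕ) : ℝ)) * (1 / n) = 2 := by push_cast; field_simp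
  simp only [e] at hs
  have e0 : ((0 : ℕ) : ℝ) * (1 / n) = 0 := by simp
  rw [e0] at hs
  rw [← hs]
  refine Finset.sum_le_sum fun i _ => ?_
  have hi : (0 : ℝ) ≤ i * (1 / n) := by positivity
  have hi' : (0 : ℝ) ≤ (i + 1) * (1 / n) := by positivity
  have := H (1 + i * (-(1 / n))) (1 + (i + 1) * (-(1 / n))) (by linarith) (by linarith) (by ring)
  refine this.trans (le_of_eq ?_)
  congr 2
  · push_cast; ring
  · ring

lemma aux_steps (n : ℕ) (hn : 0 < n) (u v : ℝ) (hu : u ≤ 1) (huv : u - v = 1 / n) :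
    0 ≤ √(1 - u) ∧ √(1 - u) ≤ √(1 - v) ∧
      (√(1 - v) - √(1 - u)) * (√(1 - v) + √(1 - u)) = 1 / n ∧ √(1 / n) ≤ √(1 - v)
      ∧ 0 < √(1 / (n : ℝ)) := by
  have hn' : (0 : ℝ) < 1 / n := by positivity
  refine ⟨Real.sqrt_nonneg _, Real.sqrt_le_sqrt (by linarith), ?_, Real.sqrt_le_sqrt (by linarith),
    Real.sqrt_pos.2 hn'⟩
  have h1 := Real.sq_sqrt (sub_nonneg.2 hu)
  have h2 := Real.sq_sqrt (show 0 ≤ 1 - v by linarith)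
  nlinarith

lemma aux_bound_half (n : ℕ) (hn : 0 < n) :
    |trapezoidal_error (fun x : ℝ => (1 - x) ^ ((1 : ℝ) / 2)) (2 * n) (-1) 1|
      ≤ √(1 / (n : ℝ)) ^ 3 := by
  have hs0 : 0 < √(1 / (n : ℝ)) := Real.sqrt_pos.2 (by positivity)
  refine (aux_tele _ (aux_cont _ (by norm_num))
    (fun y => -(√(1 / (n : ℝ)) ^ 4 / (√(1 / (n : ℝ)) + √y))) n hn ?_).trans ?_
  · intro u v hu hv huv
    rw [aux_err_half u v hu hv]
    obtain ⟨ha, hab, hh, hsb, hs⟩ := aux_steps n hn u v hu huv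
    have hsq : √(1 / (n : ℝ)) ^ 2 = 1 / n := Real.sq_sqrt (by positivity)
    rw [← hsq] at hh
    clear huv hsq
    generalize √(1 / (n : ℝ)) = s at *
    generalize √(1 - u) = a at *
    generalize √(1 - v) = b at *
    rw [abs_of_nonneg (by have : 0 ≤ b - a := by linarith
                          positivity)]
    have hb : 0 < b := by linarith
    have e : -(s ^ 4 / (s + b)) - -(s ^ 4 / (s + a))
        = s ^ 4 * (b - a) / ((s + a) * (s + b)) := by
      field_simp; ring
    rw [e, le_div_iff₀ (by positivity)]
    have h4 : s ^ 4 = ((b - a) * (b + a)) ^ 2 := by rw [hh]; ring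
    rw [h4]
    have h5 : (s + a) * (s + b) ≤ 2 * (b + a) ^ 2 := by nlinarith
    have h6 : 0 ≤ (b - a) ^ 3 := pow_nonneg (by linarith) 3
    have h7 := mul_le_mul_of_nonneg_left h5 h6
    have h8 : 0 ≤ (b - a) ^ 3 * (b + a) ^ 2 := by positivity
    nlinarith
  · simp only [Real.sqrt_zero, add_zero]
    have : 0 ≤ √(1 / (n : ℝ)) ^ 4 / (√(1 / (n : ℝ)) + √2) := by positivity
    have e : √(1 / (n : ℝ)) ^ 4 / √(1 / (n : ℝ)) = √(1 / (n : ℝ)) ^ 3 := by field_simp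
    linarith

lemma aux_bound_three_half (n : ℕ) (hn : 0 < n) :
    |trapezoidal_error (fun x : ℝ => (1 - x) ^ ((3 : ℝ) / 2)) (2 * n) (-1) 1|
      ≤ 2 * (1 / (n : ℝ)) ^ 2 := by
  refine (aux_tele _ (aux_cont _ (by norm_num))
    (fun y => (1 / (n : ℝ)) ^ 2 * √y) n hn ?_).trans ?_
  · intro u v hu hv huv
    rw [aux_err_three_half u v hu hv, abs_neg]
    obtain ⟨ha, hab, hh, hsb, hs⟩ := aux_steps n hn u v hu huv
    rw [← hh]
    generalize √(1 - u) = a at *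
    generalize √(1 - v) = b at *
    have hb : 0 ≤ b := by linarith
    have hd : 0 ≤ b - a := by linarith
    rw [abs_of_nonneg (by positivity)]
    have h6 : 0 ≤ (b - a) ^ 3 := by positivity
    have h7 : a ^ 2 + 3 * a * b + b ^ 2 ≤ 10 * (b + a) ^ 2 := by nlinarith [mul_nonneg ha hb]
    have h8 := mul_le_mul_of_nonneg_left h7 h6
    nlinarith
  · simp only [Real.sqrt_zero, mul_zero, sub_zero]
    have : √2 ≤ 2 := by rw [Real.sqrt_le_left (by norm_num)]; norm_num
    rw [mul_comm]
    gcongr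

lemma aux_bound_c2 (f : ℝ → ℝ) (hf : ContDiffOn ℝ 2 f (Icc (-1 : ℝ) 1)) :
    ∃ C : ℝ, 0 ≤ C ∧ ∀ n : ℕ, 0 < n →
      |trapezoidal_error f (2 * n) (-1) 1| ≤ C * (1 / (n : ℝ)) ^ 2 := by
  have hlt : (-1 : ℝ) < 1 := by norm_num
  have hc := hf.continuousOn_iteratedDerivWithin (m := 2) le_rfl (uniqueDiffOn_Icc hlt)
  obtain ⟨C, hC⟩ := isCompact_Icc.exists_bound_of_continuousOn hc
  have hC0 : 0 ≤ C := (norm_nonneg _).trans (hC 1 (by simp))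
  refine ⟨C, hC0, fun n hn => ?_⟩
  have hu : uIcc (-1 : ℝ) 1 = Icc (-1) 1 := uIcc_of_le hlt.le
  have := trapezoidal_error_le_of_c2 (f := f) (a := -1) (b := 1) (ζ := C) (N := 2 * n)
    (by rwa [hu]) (by
      intro x
      rw [hu]
      by_cases hx : x ∈ Icc (-1 : ℝ) 1
      · exact hC x hx
      · rw [iteratedDerivWithin_succ, derivWithin_zero_of_notMem_closure
          (by rwa [closure_Icc]), abs_zero]
        exact hC0) (by omega)
  refine this.trans ?_
  have hn' : (0 : ℝ) < n := by exact_mod_cast hn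
  push_cast
  norm_num
  rw [div_le_iff₀ (by positivity)]
  field_simp
  nlinarith

lemma aux_bridge (F : ℝ → ℝ) (n : ℕ) (hn : 0 < n) :
    (1/(2*(n : ℝ))) * F (-1) + (1/(2*(n : ℝ))) * F 1 +
          ∑ k ∈ Finset.Icc (-(n : ℤ) + 1) ((n : ℤ) - 1), (1/(n : ℝ)) * F ((k : ℝ)/(n : ℝ))
      = trapezoidal_integral F (2 * n) (-1) 1 := by
  have hn' : (0 : ℝ) < n := by exact_mod_cast hn
  have hs : ∑ k ∈ Finset.Icc (-(n : ℤ) + 1) ((n : ℤ) - 1), (1/(n : ℝ)) * F ((k : ℝ)/(n : ℝ))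
      = ∑ j ∈ Finset.range (2 * n - 1),
        (1/(n : ℝ)) * F (-1 + ((j : ℝ) + 1) * (1 - (-1)) / ((2 * n : ℕ) : ℝ)) := by
    refine Finset.sum_nbij' (fun k => (k + n - 1).toNat) (fun j => (j : ℤ) + 1 - n) ?_ ?_ ?_ ?_ ?_
    · intro k hk; simp at hk ⊢; omega
    · intro k hk; simp at hk ⊢; omega
    · intro k hk; simp at hk ⊢; omega
    · intro k hk; simp at hk ⊢
    · intro k hk
      simp at hk
      obtain ⟨j, hj⟩ : ∃ j : ℕ, k = (j : ℤ) + 1 - n := ⟨(k + n - 1).toNat, by omega⟩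
      subst hj
      have : ((j : ℤ) + 1 - n + n - 1).toNat = j := by omega
      simp only [this]
      congr 2
      push_cast
      field_simp
      ring
  rw [hs, trapezoidal_integral, mul_add, Finset.mul_sum]
  have e : (1 - (-1 : ℝ)) / ((2 * n : ℕ) : ℝ) = 1 / n := by push_cast; field_simp; ring
  rw [e]
  congr 1
  field_simp

lemma aux_lin (f g k : ℝ → ℝ) (c d : ℝ) (m : ℕ) (hf : IntervalIntegrable f volume (-1) 1)
    (hg : IntervalIntegrable g volume (-1) 1) (hk : IntervalIntegrable k volume (-1) 1) :
    trapezoidal_error (fun x => c * f x + d * g x + k x) m (-1) 1 =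
      c * trapezoidal_error f m (-1) 1 + d * trapezoidal_error g m (-1) 1
        + trapezoidal_error k m (-1) 1 := by
  unfold trapezoidal_error trapezoidal_integral
  rw [intervalIntegral.integral_add ((hf.const_mul c).add (hg.const_mul d)) hk,
    intervalIntegral.integral_add (hf.const_mul c) (hg.const_mul d),
    intervalIntegral.integral_const_mul, intervalIntegral.integral_const_mul,
    Finset.sum_add_distrib, Finset.sum_add_distrib, ← Finset.mul_sum, ← Finset.mul_sum]
  ring

/-- Proposition 1, item 1, for z₀ = -1: if F₁(x) = c₁(1-x)^{1/2} + c₂(1-x)^{3/2} + Ft(x)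
on [-1,1] with Ft ∈ C²[-1,1], then the trapezoid-type Riemann sum error Rₙ satisfies
|Rₙ| ≤ L₁ / n^{3/2} for all n ≥ N. -/
theorem riemann_error_sqrt_trapezoid_neg_one
    (N : ℕ) (hN : 0 < N) (F₁ Ft : ℝ → ℝ) (c₁ c₂ : ℝ)
    (hFt : ContDiffOn ℝ 2 Ft (Set.Icc (-1 : ℝ) 1))
    (hrep : ∀ x ∈ Set.Icc (-1 : ℝ) 1,
      F₁ x = c₁ * (1 - x) ^ ((1 : ℝ)/2) + c₂ * (1 - x) ^ ((3 : ℝ)/2) + Ft x) :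
    ∃ L₁ > (0 : ℝ), ∀ n : ℕ, N ≤ n →
      |(∫ x in (-1 : ℝ)..1, F₁ x) -
        ((1/(2*(n : ℝ))) * F₁ (-1) + (1/(2*(n : ℝ))) * F₁ 1 +
          ∑ k ∈ Finset.Icc (-(n : ℤ) + 1) ((n : ℤ) - 1), (1/(n : ℝ)) * F₁ ((k : ℝ)/(n : ℝ)))|
        ≤ L₁ / (n : ℝ) ^ ((3 : ℝ)/2) := by
  obtain ⟨C, hC0, hC⟩ := aux_bound_c2 Ft hFt
  refine ⟨|c₁| + |c₂| * 2 + C + 1, by positivity, fun n hNn => ?_⟩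
  have hn : 0 < n := by omega
  have hn' : (0 : ℝ) < n := by exact_mod_cast hn
  have hlt : (-1 : ℝ) ≤ 1 := by norm_num
  have hint : ∫ x in (-1 : ℝ)..1, F₁ x = ∫ x in (-1 : ℝ)..1,
      (c₁ * (1 - x) ^ ((1 : ℝ)/2) + c₂ * (1 - x) ^ ((3 : ℝ)/2) + Ft x) := by
    refine intervalIntegral.integral_congr fun x hx => ?_
    rw [uIcc_of_le hlt] at hx
    exact hrep x hx
  have hsum : ∑ k ∈ Finset.Icc (-(n : ℤ) + 1) ((n : ℤ) - 1), (1/(n : ℝ)) * F₁ ((k : ℝ)/(n : ℝ))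
      = ∑ k ∈ Finset.Icc (-(n : ℤ) + 1) ((n : ℤ) - 1), (1/(n : ℝ)) *
        (fun x : ℝ => c₁ * (1 - x) ^ ((1 : ℝ)/2) + c₂ * (1 - x) ^ ((3 : ℝ)/2) + Ft x)
          ((k : ℝ)/(n : ℝ)) := by
    refine Finset.sum_congr rfl fun k hk => ?_
    rw [Finset.mem_Icc] at hk
    rw [hrep]
    have h1 : (-(n : ℝ)) ≤ k := by exact_mod_cast (by omega : -(n : ℤ) ≤ k)
    have h2 : (k : ℝ) ≤ n := by exact_mod_cast (by omega : k ≤ (n : ℤ))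
    constructor
    · rw [le_div_iff₀ hn']; linarith
    · rw [div_le_iff₀ hn']; linarith
  have hF1 := hrep 1 (by simp)
  have hFm := hrep (-1) (by simp)
  rw [hint, hsum, hF1, hFm]
  have hb := aux_bridge
    (fun x : ℝ => c₁ * (1 - x) ^ ((1 : ℝ)/2) + c₂ * (1 - x) ^ ((3 : ℝ)/2) + Ft x) n hn
  have hl := aux_lin (fun x : ℝ => (1 - x) ^ ((1 : ℝ)/2)) (fun x : ℝ => (1 - x) ^ ((3 : ℝ)/2)) Ft
    c₁ c₂ (2 * n) ((aux_cont _ (by norm_num)).intervalIntegrable _ _)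
    ((aux_cont _ (by norm_num)).intervalIntegrable _ _)
    (hFt.continuousOn.intervalIntegrable_of_Icc hlt)
  rw [hb, abs_sub_comm]
  change |trapezoidal_error _ _ _ _| ≤ _
  rw [hl]
  have b1 := aux_bound_half n hn
  have b2 := aux_bound_three_half n hn
  have b3 := hC n hn
  have hs : √(1 / (n : ℝ)) ^ 3 = 1 / (n : ℝ) ^ ((3 : ℝ) / 2) := by
    rw [show (3 : ℝ) / 2 = ((3 : ℕ) : ℝ) / 2 by norm_num, aux_rpow_half hn'.le, one_div,
      Real.sqrt_inv, one_div, inv_pow]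
  have hn1 : (1 : ℝ) ≤ n := by exact_mod_cast hn
  have h2 : (1 / (n : ℝ)) ^ 2 ≤ 1 / (n : ℝ) ^ ((3 : ℝ) / 2) := by
    rw [one_div_pow]
    apply one_div_le_one_div_of_le (by positivity)
    rw [← Real.rpow_natCast]
    exact Real.rpow_le_rpow_of_exponent_le hn1 (by norm_num)
  rw [hs] at b1
  have h0 : 0 < 1 / (n : ℝ) ^ ((3 : ℝ) / 2) := by positivity
  rw [div_eq_mul_one_div (|c₁| + |c₂| * 2 + C + 1)]
  generalize 1 / (n : ℝ) ^ ((3 : ℝ) / 2) = t at *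
  refine (abs_add_le _ _).trans ?_
  refine (add_le_add_left (abs_add_le _ _) _).trans ?_
  rw [abs_mul, abs_mul]
  have m1 := mul_le_mul_of_nonneg_left b1 (abs_nonneg c₁)
  have m2 := mul_le_mul_of_nonneg_left (b2.trans (mul_le_mul_of_nonneg_left h2 zero_le_two))
    (abs_nonneg c₂)
  have m3 := b3.trans (mul_le_mul_of_nonneg_left h2 hC0)
  linarith
end

section
/- Let N ∈ ℕ and let F₁ : [-1, 1] → ℝ be a function that can be represented as F₁(x) = c₁(1-x)^{1/2} + c₂(1-x)^{3/2} + c₃(1-x)^{5/2} + c₄(1-x)^{7/2} + F̄₁(x), where c₁, c₂, c₃, c₄ ∈ ℝ and F̄₁ is four times continuously differentiable on [-1, 1]. Then there exists a constant L̄₁ > 0 (depending on F₁ and N) such that for all n ≥ N, |(n+1)² R_{n+1} − n² Rₙ| ≤ L̄₁ / n^{1/2}. -/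
open MeasureTheory Set

lemma te_one (f : ℝ → ℝ) (a b : ℝ) :
    trapezoidal_error f 1 a b = (b - a) / 2 * (f a + f b) - ∫ x in a..b, f x := by
  rw [trapezoidal_error, trapezoidal_integral_one]

/-- Cell error bound. -/
lemma te_cell {f f1 f2 : ℝ → ℝ} {a b ζ : ℝ} (hab : a < b)
    (h1 : ∀ x ∈ Icc a b, HasDerivWithinAt f (f1 x) (Icc a b) x)
    (h2 : ∀ x ∈ Icc a b, HasDerivWithinAt f1 (f2 x) (Icc a b) x)
    (hb : ∀ x ∈ Icc a b, |f2 x| ≤ ζ) :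
    |trapezoidal_error f 1 a b| ≤ (b - a) ^ 3 * ζ / 12 := by
  have hu := uniqueDiffOn_Icc hab
  have e1 : EqOn (derivWithin f (Icc a b)) f1 (Icc a b) :=
    fun x hx => (h1 x hx).derivWithin (hu x hx)
  have e2 : EqOn (derivWithin (derivWithin f (Icc a b)) (Icc a b)) f2 (Icc a b) := by
    intro x hx
    rw [derivWithin_congr e1 (e1 hx)]
    exact (h2 x hx).derivWithin (hu x hx)
  have hζ : 0 ≤ ζ := (abs_nonneg _).trans (hb a ⟨le_rfl, hab.le⟩)
  have := trapezoidal_error_le (f := f) (a := a) (b := b) (ζ := ζ) (N := 1)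
    (by rw [uIcc_of_lt hab]; exact fun x hx => (h1 x hx).differentiableWithinAt)
    (by
      rw [uIcc_of_lt hab]
      exact fun x hx => ((h2 x hx).congr_of_mem e1 hx).differentiableWithinAt)
    (by
      intro x
      rw [uIcc_of_lt hab]
      by_cases hx : x ∈ Icc a b
      · simp only [iteratedDerivWithin_succ', iteratedDerivWithin_zero]
        rw [e2 hx]; exact hb x hx
      · rw [iteratedDerivWithin_succ, derivWithin_zero_of_notMem_closure
          (by rwa [closure_Icc]), abs_zero]
        exact hζ) one_pos
  rw [abs_of_pos (sub_pos.2 hab)] at this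
  simpa using this

lemma te_sum_form (F : ℝ → ℝ) (n : ℕ) (hn : 0 < n) :
    (∫ x in (-1 : ℝ)..1, F x) -
            ((1/(2*(n : ℝ))) * F (-1) + (1/(2*(n : ℝ))) * F 1 +
              ∑ k ∈ Finset.Icc (-(n : ℤ) + 1) ((n : ℤ) - 1),
                (1/(n : ℝ)) * F ((k : ℝ)/(n : ℝ)))
    = - trapezoidal_error F (2 * n) (-1) 1 := by
  have hn' : (n : ℝ) ≠ 0 := by positivity
  have hs : ∑ k ∈ Finset.Icc (-(n : ℤ) + 1) ((n : ℤ) - 1), (1/(n : ℝ)) * F ((k : ℝ)/(n : ℝ))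
      = ∑ k ∈ Finset.range (2 * n - 1), (1/(n : ℝ)) * F (-1 + (k + 1) * (1 - -1) / (2 * n : ℕ)) := by
    symm
    apply Finset.sum_bij (fun (k : ℕ) _ => (k : ℤ) + 1 - n)
    · intro k hk
      simp only [Finset.mem_range, Finset.mem_Icc] at *
      omega
    · intro a _ b _ h
      omega
    · intro b hb
      simp only [Finset.mem_Icc] at hb
      refine ⟨(b + n - 1).toNat, ?_, ?_⟩
      · simp only [Finset.mem_range]; omega
      · omega
    · intro k hk
      congr 2
      push_cast
      field_simp
      ring
  rw [hs, ← Finset.mul_sum, trapezoidal_error, trapezoidal_integral]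
  generalize Finset.sum (M := ℝ) _ _ = S
  push_cast
  field_simp
  ring

lemma te_add {f g : ℝ → ℝ} {a b : ℝ} (N : ℕ) (hf : IntervalIntegrable f volume a b)
    (hg : IntervalIntegrable g volume a b) :
    trapezoidal_error (fun x => f x + g x) N a b
      = trapezoidal_error f N a b + trapezoidal_error g N a b := by
  simp only [trapezoidal_error, trapezoidal_integral]
  rw [intervalIntegral.integral_add hf hg, Finset.sum_add_distrib]
  ring

lemma te_const_mul (f : ℝ → ℝ) (c : ℝ) {a b : ℝ} (N : ℕ) :
    trapezoidal_error (fun x => c * f x) N a b = c * trapezoidal_error f N a b := by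
  simp only [trapezoidal_error, trapezoidal_integral]
  rw [intervalIntegral.integral_const_mul, ← Finset.mul_sum]
  ring

lemma te_smooth_cell {f f1 f2 : ℝ → ℝ} {a b L : ℝ} (hab : a < b)
    (h1 : ∀ x ∈ Icc a b, HasDerivWithinAt f (f1 x) (Icc a b) x)
    (h2 : ∀ x ∈ Icc a b, HasDerivWithinAt f1 (f2 x) (Icc a b) x)
    (hL : 0 ≤ L)
    (hb : ∀ x ∈ Icc a b, |f2 x - f2 a| ≤ L * (x - a)) :
    |trapezoidal_error f 1 a b - (b - a) ^ 2 / 12 * (f1 b - f1 a)| ≤ L * (b - a) ^ 4 / 6 := by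
  set c := f2 a with hc
  have hd1 : ∀ x : ℝ, HasDerivAt (fun x : ℝ => -c / 2 * (x - a) ^ 2) (-c * (x - a)) x := by
    intro x
    have := (((hasDerivAt_id x).sub_const a).pow 2).const_mul (-c / 2)
    exact this.congr_deriv (by simp; ring)
  have hd2 : ∀ x : ℝ, HasDerivAt (fun x : ℝ => -c * (x - a)) (-c) x := by
    intro x
    have := ((hasDerivAt_id x).sub_const a).const_mul (-c)
    exact this.congr_deriv (by simp)
  have B : ∀ x ∈ Icc a b, |f2 x + -c| ≤ L * (b - a) := by
    intro x hx
    refine (hb x hx).trans ?_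
    gcongr
    exact hx.2
  have key := te_cell (f := fun x => f x + (-c / 2 * (x - a) ^ 2))
    (f1 := fun x => f1 x + -c * (x - a)) (f2 := fun x => f2 x + -c) (ζ := L * (b - a)) hab
    (fun x hx => (h1 x hx).add (hd1 x).hasDerivWithinAt)
    (fun x hx => (h2 x hx).add (hd2 x).hasDerivWithinAt) B
  have hfi : IntervalIntegrable f volume a b :=
    ContinuousOn.intervalIntegrable_of_Icc hab.le (fun x hx => (h1 x hx).continuousWithinAt)
  rw [te_add 1 hfi (Continuous.intervalIntegrable (by fun_prop) _ _), te_one (fun x => -c / 2 * (x - a) ^ 2)] at key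
  have hI : ∫ x in a..b, -c / 2 * (x - a) ^ 2 = -c / 6 * (b - a) ^ 3 := by
    rw [intervalIntegral.integral_const_mul,
      intervalIntegral.integral_comp_sub_right (fun x => x ^ 2) a, integral_pow]
    simp; ring
  rw [hI] at key
  have key2 := norm_image_sub_le_of_norm_deriv_le_segment' (a := a) (b := b)
    (f := fun x => f1 x + -c * (x - a)) (f' := fun x => f2 x + -c) (C := L * (b - a))
    (fun x hx => (h2 x hx).add (hd2 x).hasDerivWithinAt)
    (fun x hx => B x (Ico_subset_Icc_self hx)) b ⟨hab.le, le_rfl⟩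
  simp only [Real.norm_eq_abs] at key2
  have hd : 0 < b - a := sub_pos.2 hab
  have key3 : |(b - a) ^ 2 / 12 * (f1 b + -c * (b - a) - (f1 a + -c * (a - a)))|
      ≤ (b - a) ^ 2 / 12 * (L * (b - a) * (b - a)) := by
    rw [abs_mul, abs_of_pos (show 0 < (b - a) ^ 2 / 12 by positivity)]
    gcongr
  have := abs_sub _ _ |>.trans (add_le_add key key3)
  calc _ = |trapezoidal_error f 1 a b +
            ((b - a) / 2 * (-c / 2 * (a - a) ^ 2 + -c / 2 * (b - a) ^ 2) - -c / 6 * (b - a) ^ 3) -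
          (b - a) ^ 2 / 12 * (f1 b + -c * (b - a) - (f1 a + -c * (a - a)))| := by
        congr 1
        ring
    _ ≤ _ := this
    _ = _ := by ring

lemma te_cells (f : ℝ → ℝ) (n : ℕ) (hn : 0 < n) (hf : IntervalIntegrable f volume (-1) 1) :
    trapezoidal_error f (2 * n) (-1) 1 =
      ∑ i ∈ Finset.range (2 * n), trapezoidal_error f 1 (-1 + i * (1 / (n:ℝ))) (-1 + (i + 1) * (1 / (n:ℝ))) := by
  have h1 : (-1 : ℝ) + (2 * n : ℕ) * (1 / (n:ℝ)) = 1 := by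
    push_cast; field_simp; norm_num
  rw [sum_trapezoidal_error_adjacent_intervals (by omega) (by rw [h1]; exact hf), h1]

lemma te_smooth (f : ℝ → ℝ) (hf : ContDiffOn ℝ 4 f (Icc (-1 : ℝ) 1)) :
    ∃ A C : ℝ, 0 ≤ C ∧ ∀ n : ℕ, 0 < n →
      |(n : ℝ) ^ 2 * trapezoidal_error f (2 * n) (-1) 1 - A| ≤ C / n := by
  set s := Icc (-1 : ℝ) 1 with hs
  have hu : UniqueDiffOn ℝ s := uniqueDiffOn_Icc (by norm_num)
  have hd : ∀ m : ℕ, m < 4 → ∀ x ∈ s,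
      HasDerivWithinAt (iteratedDerivWithin m f s) (iteratedDerivWithin (m+1) f s x) s x := by
    intro m hm x hx
    rw [iteratedDerivWithin_succ]
    exact (hf.differentiableOn_iteratedDerivWithin (by exact_mod_cast hm) hu x hx).hasDerivWithinAt
  have h3 : ContinuousOn (iteratedDerivWithin 3 f s) s :=
    fun x hx => (hd 3 (by norm_num) x hx).continuousWithinAt
  obtain ⟨L, hL⟩ := isCompact_Icc.exists_bound_of_continuousOn h3
  have hL0 : 0 ≤ L := (norm_nonneg _).trans (hL 0 (by norm_num))
  have hlip : ∀ x ∈ s, ∀ y ∈ s, |iteratedDerivWithin 2 f s y - iteratedDerivWithin 2 f s x| ≤ L * |y - x| :=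
    fun x hx y hy => (convex_Icc (-1 : ℝ) 1).norm_image_sub_le_of_norm_hasDerivWithin_le
      (hd 2 (by norm_num)) hL hx hy
  have hfi : IntervalIntegrable f volume (-1) 1 :=
    hf.continuousOn.intervalIntegrable_of_Icc (by norm_num)
  set f1 := iteratedDerivWithin 1 f s
  refine ⟨(f1 1 - f1 (-1)) / 12, L / 3, by positivity, fun n hn => ?_⟩
  have hn' : (0:ℝ) < n := by positivity
  have htel : ∑ i ∈ Finset.range (2 * n), (1 / (n:ℝ)) ^ 2 / 12 *
      (f1 (-1 + (i + 1) * (1 / (n:ℝ))) - f1 (-1 + i * (1 / (n:ℝ)))) =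
      (1 / (n:ℝ)) ^ 2 / 12 * (f1 1 - f1 (-1)) := by
    rw [← Finset.mul_sum]
    congr 1
    have := Finset.sum_range_sub (fun i : ℕ => f1 (-1 + i * (1 / (n:ℝ)))) (2 * n)
    push_cast at this
    rw [this]
    congr 2
    · field_simp; norm_num
    · ring_nf
  have hcell : ∀ i ∈ Finset.range (2 * n),
      |trapezoidal_error f 1 (-1 + i * (1 / (n:ℝ))) (-1 + (i + 1) * (1 / (n:ℝ))) -
        (1 / (n:ℝ)) ^ 2 / 12 * (f1 (-1 + (i + 1) * (1 / (n:ℝ))) - f1 (-1 + i * (1 / (n:ℝ))))|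
      ≤ L * (1 / (n:ℝ)) ^ 4 / 6 := by
    intro i hi
    have hi' : (i:ℝ) + 1 ≤ 2 * n := by
      have := Finset.mem_range.1 hi
      exact_mod_cast this
    set a := -1 + i * (1 / (n:ℝ)) with ha
    set b := -1 + (i + 1) * (1 / (n:ℝ)) with hb
    have hba : b - a = 1 / (n:ℝ) := by rw [ha, hb]; ring
    have hab : a < b := by
      have : 0 < 1 / (n:ℝ) := by positivity
      linarith
    have hsub : Icc a b ⊆ s := by
      apply Icc_subset_Icc
      · rw [ha]; have : 0 ≤ i * (1 / (n:ℝ)) := by positivity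
        linarith
      · rw [hb]
        have : (i + 1) * (1 / (n:ℝ)) ≤ 2 := by
          rw [mul_one_div, div_le_iff₀ hn']; exact hi'
        linarith
    have hd0 := hd 0 (by norm_num)
    rw [iteratedDerivWithin_zero] at hd0
    have := te_smooth_cell (f := f) (f1 := f1) (f2 := iteratedDerivWithin 2 f s) hab
      (fun x hx => (hd0 x (hsub hx)).mono hsub)
      (fun x hx => (hd 1 (by norm_num) x (hsub hx)).mono hsub) hL0
      (fun x hx => by
        have := hlip a (hsub ⟨le_rfl, hab.le⟩) x (hsub hx)
        rwa [abs_of_nonneg (sub_nonneg.2 hx.1)] at this)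
    rwa [hba] at this
  have hsum := (Finset.abs_sum_le_sum_abs _ _).trans (Finset.sum_le_sum hcell)
  rw [Finset.sum_sub_distrib, htel, ← te_cells f n hn hfi] at hsum
  simp only [Finset.sum_const, Finset.card_range, nsmul_eq_mul] at hsum
  have e : (n : ℝ) ^ 2 * trapezoidal_error f (2 * n) (-1) 1 - (f1 1 - f1 (-1)) / 12
    = (n:ℝ)^2 * (trapezoidal_error f (2 * n) (-1) 1 - (1 / (n:ℝ)) ^ 2 / 12 * (f1 1 - f1 (-1))) := by
    field_simp
  rw [e, abs_mul, abs_of_pos (by positivity)]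
  calc _ ≤ _ := mul_le_mul_of_nonneg_left hsum (by positivity)
    _ = _ := by push_cast; field_simp; ring

lemma rpow_cmp {x y : ℝ} (β : ℝ) (hx : 0 < x) (hy : 0 < y) (h1 : x ≤ 4 * y) (h2 : y ≤ 4 * x) :
    x ^ β ≤ 4 ^ |β| * y ^ β := by
  have hxy : x = (x / y) * y := by field_simp
  have : (x / y) ^ β ≤ 4 ^ |β| := by
    rcases le_total 0 β with hβ | hβ
    · rw [abs_of_nonneg hβ]
      apply Real.rpow_le_rpow (by positivity) _ hβ
      rw [div_le_iff₀ hy]; exact h1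
    · rw [abs_of_nonpos hβ, show (x / y) ^ β = (y / x) ^ (-β) by
        rw [Real.rpow_neg (by positivity), ← Real.inv_rpow (by positivity), inv_div]]
      apply Real.rpow_le_rpow (by positivity) _ (by linarith)
      rw [div_le_iff₀ hx]; exact h2
  calc x ^ β = (x / y) ^ β * y ^ β := by
        rw [← Real.mul_rpow (by positivity) hy.le, ← hxy]
    _ ≤ _ := by gcongr

lemma te_pow_scale (α : ℝ) (hα : 0 < α) (n : ℕ) (hn : 0 < n) :
    trapezoidal_error (fun x => (1 - x) ^ α) (2 * n) (-1) 1 =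
      (n:ℝ) ^ (-α - 1) * ∑ j ∈ Finset.range (2 * n),
        trapezoidal_error (fun t => t ^ α) 1 (j:ℝ) (j + 1) := by
  have hn' : (0:ℝ) < n := by positivity
  have hc : Continuous (fun x : ℝ => (1 - x) ^ α) :=
    (continuous_const.sub continuous_id).rpow_const (fun _ => Or.inr hα.le)
  have h1 : (1 : ℝ) + (2 * n : ℕ) * (-1 / (n:ℝ)) = -1 := by
    push_cast; field_simp; norm_num
  have hs := sum_trapezoidal_error_adjacent_intervals (f := fun x : ℝ => (1 - x) ^ α)
    (N := 2 * n) (a := 1) (h := -1 / (n:ℝ)) (by omega) (hc.intervalIntegrable _ _)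
  rw [h1] at hs
  rw [trapezoidal_error_symm _ (by omega), ← hs, Finset.mul_sum, ← Finset.sum_neg_distrib]
  apply Finset.sum_congr rfl
  intro i _
  rw [te_one, te_one]
  have hp : ∀ x : ℝ, 0 ≤ x → (x / n) ^ α = (n:ℝ) ^ (-α) * x ^ α := by
    intro x hx
    rw [Real.div_rpow hx hn'.le, Real.rpow_neg hn'.le]
    field_simp
  have hI := intervalIntegral.integral_comp_sub_div (a := (i:ℝ)) (b := i + 1)
    (fun x : ℝ => (1 - x) ^ α) hn'.ne' 1
  have hI2 : ∫ x in (i:ℝ)..(i+1), (1 - (1 - x / (n:ℝ))) ^ α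
      = (n:ℝ) ^ (-α) * ∫ x in (i:ℝ)..(i+1), x ^ α := by
    rw [← intervalIntegral.integral_const_mul]
    apply intervalIntegral.integral_congr
    intro x hx
    rw [uIcc_of_le (by linarith)] at hx
    have hx0 : 0 ≤ x := le_trans (by positivity) hx.1
    simp only [sub_sub_cancel]
    exact hp x hx0
  rw [hI2, smul_eq_mul] at hI
  rw [intervalIntegral.integral_symm]
  rw [show (1:ℝ) + i * (-1 / (n:ℝ)) = 1 - i / n by ring,
    show (1:ℝ) + (i + 1) * (-1 / (n:ℝ)) = 1 - (i + 1) / n by ring]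
  simp only [sub_sub_cancel]
  rw [hp i (by positivity), hp (i + 1) (by positivity), Real.rpow_sub_one hn'.ne']
  rw [show (∫ x in (i:ℝ)..(i+1), x ^ α) = (n:ℝ) * (∫ x in (1 - (i + 1) / (n:ℝ))..(1 - i / (n:ℝ)), (1 - x) ^ α) / (n:ℝ) ^ (-α) by
    rw [← hI]; field_simp]
  have : (n:ℝ) ^ (-α) ≠ 0 := by positivity
  generalize (n:ℝ) ^ (-α) = q at *
  generalize intervalIntegral (E := ℝ) _ _ _ _ = I
  field_simp
  ring

lemma te_pow_cell (α : ℝ) (hα : 0 < α) : ∃ C : ℝ, 0 ≤ C ∧ ∀ j : ℕ,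
    |trapezoidal_error (fun t => t ^ α) 1 (j:ℝ) (j + 1)| ≤ C * ((j:ℝ) + 1) ^ (α - 2) := by
  set K := |α * (α - 1)| * 4 ^ |α - 2| / 12
  set e0 := |trapezoidal_error (fun t => t ^ α) 1 (0:ℝ) 1|
  have hK : 0 ≤ K := by positivity
  have he0 : 0 ≤ e0 := abs_nonneg _
  refine ⟨e0 + K, by positivity, fun j => ?_⟩
  rcases Nat.eq_zero_or_pos j with rfl | hj
  · simp [e0]; exact hK
  have hj' : (1:ℝ) ≤ j := by exact_mod_cast hj
  have hpos : ∀ x ∈ Icc (j:ℝ) (j+1), 0 < x := fun x hx => by linarith [hx.1]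
  have := te_cell (f := fun t => t ^ α) (f1 := fun t => α * t ^ (α - 1))
    (f2 := fun t => α * ((α - 1) * t ^ (α - 1 - 1))) (a := j) (b := j + 1)
    (ζ := |α * (α - 1)| * (4 ^ |α - 2| * ((j:ℝ) + 1) ^ (α - 2))) (by linarith)
    (fun x hx => (Real.hasDerivAt_rpow_const (Or.inl (hpos x hx).ne')).hasDerivWithinAt)
    (fun x hx => ((Real.hasDerivAt_rpow_const (Or.inl (hpos x hx).ne')).const_mul α).hasDerivWithinAt)
    (by
      intro x hx
      rw [← mul_assoc, abs_mul, show α - 1 - 1 = α - 2 by ring,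
        abs_of_pos (Real.rpow_pos_of_pos (hpos x hx) _)]
      gcongr
      exact rpow_cmp _ (hpos x hx) (by positivity) (by linarith [hx.2]) (by linarith [hx.1]))
  refine this.trans ?_
  have h0 : 0 ≤ e0 * ((j:ℝ) + 1) ^ (α - 2) := by positivity
  calc _ = K * ((j:ℝ) + 1) ^ (α - 2) := by simp only [K]; ring
    _ ≤ _ := by rw [add_mul]; linarith

lemma rpow_succ_sub (β : ℝ) : ∃ C : ℝ, 0 ≤ C ∧ ∀ n : ℕ, 0 < n →
    |((n:ℝ) + 1) ^ β - (n:ℝ) ^ β| ≤ C * (n:ℝ) ^ (β - 1) := by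
  refine ⟨|β| * 4 ^ |β - 1|, by positivity, fun n hn => ?_⟩
  have hn' : (1:ℝ) ≤ n := by exact_mod_cast hn
  have hpos : ∀ x ∈ Icc (n:ℝ) (n+1), 0 < x := fun x hx => by linarith [hx.1]
  have := norm_image_sub_le_of_norm_deriv_le_segment' (a := (n:ℝ)) (b := n + 1)
    (f := fun x => x ^ β) (f' := fun x => β * x ^ (β - 1))
    (C := |β| * (4 ^ |β - 1| * (n:ℝ) ^ (β - 1)))
    (fun x hx => (Real.hasDerivAt_rpow_const (Or.inl (hpos x hx).ne')).hasDerivWithinAt)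
    (by
      intro x hx
      have hx := Ico_subset_Icc_self hx
      rw [Real.norm_eq_abs, abs_mul, abs_of_pos (Real.rpow_pos_of_pos (hpos x hx) _)]
      gcongr
      exact rpow_cmp _ (hpos x hx) (by positivity) (by linarith [hx.2]) (by linarith [hx.1]))
    (n + 1) ⟨by linarith, le_rfl⟩
  simp only [Real.norm_eq_abs] at this
  calc _ ≤ _ := this
    _ = _ := by ring

lemma te_pow_sum (α : ℝ) (hα : 1 / 2 ≤ α) : ∃ C : ℝ, 0 ≤ C ∧ ∀ m : ℕ,
    |∑ j ∈ Finset.range m, trapezoidal_error (fun t => t ^ α) 1 (j:ℝ) (j + 1)|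
      ≤ C * (m:ℝ) ^ (α - 1/2) := by
  obtain ⟨C, hC, h⟩ := te_pow_cell α (by linarith)
  have hsm : Summable (fun j : ℕ => ((j:ℝ) + 1) ^ (-(3/2) : ℝ)) := by
    have := (summable_nat_add_iff 1).2 (Real.summable_nat_rpow (p := -(3/2)) |>.2 (by norm_num))
    simpa using this
  refine ⟨C * ∑' j : ℕ, ((j:ℝ) + 1) ^ (-(3/2) : ℝ), 
    mul_nonneg hC (tsum_nonneg fun j => by positivity), fun m => ?_⟩
  calc _ ≤ ∑ j ∈ Finset.range m, C * (((j:ℝ) + 1) ^ (-(3/2) : ℝ) * (m:ℝ) ^ (α - 1/2)) := by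
        refine (Finset.abs_sum_le_sum_abs _ _).trans (Finset.sum_le_sum fun j hj => ?_)
        refine (h j).trans ?_
        have hjm : (j:ℝ) + 1 ≤ m := by exact_mod_cast Finset.mem_range.1 hj
        rw [show α - 2 = -(3/2) + (α - 1/2) by ring, Real.rpow_add (by positivity)]
        gcongr
    _ = C * (∑ j ∈ Finset.range m, ((j:ℝ) + 1) ^ (-(3/2) : ℝ)) * (m:ℝ) ^ (α - 1/2) := by
        rw [← Finset.mul_sum, ← Finset.sum_mul, mul_assoc]
    _ ≤ _ := by
        gcongr
        exact hsm.sum_le_tsum _ (fun j _ => by positivity)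

lemma te_pow (α : ℝ) (hα : 1 / 2 ≤ α) : ∃ C : ℝ, 0 ≤ C ∧ ∀ n : ℕ, 0 < n →
    |((n:ℝ) + 1) ^ 2 * trapezoidal_error (fun x => (1 - x) ^ α) (2 * (n + 1)) (-1) 1
      - (n:ℝ) ^ 2 * trapezoidal_error (fun x => (1 - x) ^ α) (2 * n) (-1) 1|
      ≤ C / (n:ℝ) ^ ((1:ℝ) / 2) := by
  obtain ⟨C1, hC1, h1⟩ := te_pow_cell α (by linarith)
  obtain ⟨C2, hC2, h2⟩ := te_pow_sum α hα
  obtain ⟨C3, hC3, h3⟩ := rpow_succ_sub (1 - α)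
  set Q := (4:ℝ) ^ |α - 1/2|
  set P := (4:ℝ) ^ |1 - α|
  set T := (4:ℝ) ^ |α - 2|
  refine ⟨C3 * (C2 * Q) + P * (C1 * T + C1 * T), by positivity, fun n hn => ?_⟩
  have hn1 : (1:ℝ) ≤ n := by exact_mod_cast hn
  have hn0 : (0:ℝ) < n := by linarith
  have sc : ∀ m : ℕ, 0 < m → (m:ℝ) ^ 2 * trapezoidal_error (fun x => (1 - x) ^ α) (2 * m) (-1) 1
      = (m:ℝ) ^ (1 - α) * ∑ j ∈ Finset.range (2 * m),
        trapezoidal_error (fun t => t ^ α) 1 (j:ℝ) (j + 1) := by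
    intro m hm
    have hm' : (0:ℝ) < m := by positivity
    rw [te_pow_scale α (by linarith) m hm, ← mul_assoc, ← Real.rpow_natCast,
      ← Real.rpow_add hm']
    congr 2
    push_cast; ring
  have sc1 := sc (n + 1) (by omega)
  push_cast at sc1
  rw [sc1, sc n hn, show 2 * (n + 1) = 2 * n + 1 + 1 by ring, Finset.sum_range_succ,
    Finset.sum_range_succ]
  set S := ∑ j ∈ Finset.range (2 * n), trapezoidal_error (fun t => t ^ α) 1 (j:ℝ) (j + 1)
  set u := trapezoidal_error (fun t => t ^ α) 1 ((2 * n : ℕ):ℝ) ((2 * n : ℕ) + 1)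
  set v := trapezoidal_error (fun t => t ^ α) 1 ((2 * n + 1 : ℕ):ℝ) ((2 * n + 1 : ℕ) + 1)
  have hS : |S| ≤ C2 * (Q * (n:ℝ) ^ (α - 1/2)) := by
    refine (h2 (2 * n)).trans ?_
    gcongr
    push_cast
    exact rpow_cmp _ (by positivity) hn0 (by linarith) (by linarith)
  have hu : |u| ≤ C1 * (T * (n:ℝ) ^ (α - 2)) := by
    refine (h1 (2 * n)).trans ?_
    gcongr
    push_cast
    exact rpow_cmp _ (by positivity) hn0 (by linarith) (by linarith)
  have hv : |v| ≤ C1 * (T * (n:ℝ) ^ (α - 2)) := by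
    refine (h1 (2 * n + 1)).trans ?_
    gcongr
    push_cast
    exact rpow_cmp _ (by positivity) hn0 (by linarith) (by linarith)
  have hp : ((n:ℝ) + 1) ^ (1 - α) ≤ P * (n:ℝ) ^ (1 - α) :=
    rpow_cmp _ (by positivity) hn0 (by linarith) (by linarith)
  have e : ((n:ℝ) + 1) ^ (1 - α) * (S + u + v) - (n:ℝ) ^ (1 - α) * S
      = (((n:ℝ) + 1) ^ (1 - α) - (n:ℝ) ^ (1 - α)) * S + ((n:ℝ) + 1) ^ (1 - α) * (u + v) := by ring
  have a1 : (n:ℝ) ^ (1 - α - 1) * (n:ℝ) ^ (α - 1/2) = (n:ℝ) ^ (-(1/2) : ℝ) := by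
    rw [← Real.rpow_add hn0]; congr 1; ring
  have a2 : (n:ℝ) ^ (1 - α) * (n:ℝ) ^ (α - 2) ≤ (n:ℝ) ^ (-(1/2) : ℝ) := by
    rw [← Real.rpow_add hn0]
    apply Real.rpow_le_rpow_of_exponent_le hn1
    linarith
  rw [e, div_eq_mul_inv, ← Real.rpow_neg hn0.le]
  calc _ ≤ |(((n:ℝ) + 1) ^ (1 - α) - (n:ℝ) ^ (1 - α))| * |S| + ((n:ℝ) + 1) ^ (1 - α) * (|u| + |v|) := by
        refine (abs_add_le _ _).trans ?_
        rw [abs_mul, abs_mul, abs_of_pos (show 0 < ((n:ℝ) + 1) ^ (1 - α) by positivity)]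
        gcongr
        exact abs_add_le _ _
    _ ≤ (C3 * (n:ℝ) ^ (1 - α - 1)) * (C2 * (Q * (n:ℝ) ^ (α - 1/2))) +
        (P * (n:ℝ) ^ (1 - α)) * (C1 * (T * (n:ℝ) ^ (α - 2)) + C1 * (T * (n:ℝ) ^ (α - 2))) := by
        gcongr
        exact h3 n hn
    _ = C3 * (C2 * Q) * ((n:ℝ) ^ (1 - α - 1) * (n:ℝ) ^ (α - 1/2)) +
        P * (C1 * T + C1 * T) * ((n:ℝ) ^ (1 - α) * (n:ℝ) ^ (α - 2)) := by ring
    _ ≤ C3 * (C2 * Q) * (n:ℝ) ^ (-(1/2) : ℝ) + P * (C1 * T + C1 * T) * (n:ℝ) ^ (-(1/2) : ℝ) := by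
        rw [a1]
        gcongr
    _ = _ := by ring

lemma te_smooth_diff (f : ℝ → ℝ) (hf : ContDiffOn ℝ 4 f (Icc (-1 : ℝ) 1)) :
    ∃ C : ℝ, 0 ≤ C ∧ ∀ n : ℕ, 0 < n →
    |((n:ℝ) + 1) ^ 2 * trapezoidal_error f (2 * (n + 1)) (-1) 1
      - (n:ℝ) ^ 2 * trapezoidal_error f (2 * n) (-1) 1| ≤ C / (n:ℝ) ^ ((1:ℝ) / 2) := by
  obtain ⟨A, C, hC, h⟩ := te_smooth f hf
  refine ⟨C + C, by positivity, fun n hn => ?_⟩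
  have hn1 : (1:ℝ) ≤ n := by exact_mod_cast hn
  have q : C / (n:ℝ) ≤ C / (n:ℝ) ^ ((1:ℝ)/2) := by
    gcongr
    calc (n:ℝ) ^ ((1:ℝ)/2) ≤ (n:ℝ) ^ (1:ℝ) :=
          Real.rpow_le_rpow_of_exponent_le hn1 (by norm_num)
      _ = n := Real.rpow_one _
  have q1 : C / ((n:ℝ) + 1) ≤ C / (n:ℝ) := by gcongr; linarith
  have b1 := h (n + 1) (by omega)
  have b2 := h n hn
  push_cast at b1
  have := (abs_sub _ _).trans (add_le_add b1 b2)
  rw [sub_sub_sub_cancel_right] at this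
  rw [add_div]
  linarith


open MeasureTheory Set

/-- Proposition 1, item 2, for z₀ = -1: if
F₁(x) = c₁(1-x)^{1/2} + c₂(1-x)^{3/2} + c₃(1-x)^{5/2} + c₄(1-x)^{7/2} + Fb(x)
on [-1,1] with Fb ∈ C⁴[-1,1], then the Riemann sum errors Rₙ satisfy
|(n+1)² R_{n+1} − n² Rₙ| ≤ L̄₁ / n^{1/2} for all n ≥ N. -/
theorem riemann_error_sqrt_second_difference_neg_one
    (N : ℕ) (hN : 0 < N) (F₁ Fb : ℝ → ℝ) (c₁ c₂ c₃ c₄ : ℝ)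
    (hFb : ContDiffOn ℝ 4 Fb (Set.Icc (-1 : ℝ) 1))
    (hrep : ∀ x ∈ Set.Icc (-1 : ℝ) 1,
      F₁ x = c₁ * (1 - x) ^ ((1 : ℝ)/2) + c₂ * (1 - x) ^ ((3 : ℝ)/2)
        + c₃ * (1 - x) ^ ((5 : ℝ)/2) + c₄ * (1 - x) ^ ((7 : ℝ)/2) + Fb x) :
    ∃ L₁ > (0 : ℝ), ∀ n : ℕ, N ≤ n →
      |((n : ℝ) + 1)^2 *
          ((∫ x in (-1 : ℝ)..1, F₁ x) -
            ((1/(2*((n : ℝ) + 1))) * F₁ (-1) + (1/(2*((n : ℝ) + 1))) * F₁ 1 +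
              ∑ k ∈ Finset.Icc (-((n : ℤ) + 1) + 1) (((n : ℤ) + 1) - 1),
                (1/((n : ℝ) + 1)) * F₁ ((k : ℝ)/((n : ℝ) + 1))))
        - (n : ℝ)^2 *
          ((∫ x in (-1 : ℝ)..1, F₁ x) -
            ((1/(2*(n : ℝ))) * F₁ (-1) + (1/(2*(n : ℝ))) * F₁ 1 +
              ∑ k ∈ Finset.Icc (-(n : ℤ) + 1) ((n : ℤ) - 1),
                (1/(n : ℝ)) * F₁ ((k : ℝ)/(n : ℝ))))|
        ≤ L₁ / (n : ℝ) ^ ((1 : ℝ)/2) := by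
  obtain ⟨C1, hC1, h1⟩ := te_pow (1/2) (by norm_num)
  obtain ⟨C2, hC2, h2⟩ := te_pow (3/2) (by norm_num)
  obtain ⟨C3, hC3, h3⟩ := te_pow (5/2) (by norm_num)
  obtain ⟨C4, hC4, h4⟩ := te_pow (7/2) (by norm_num)
  obtain ⟨C5, hC5, h5⟩ := te_smooth_diff Fb hFb
  refine ⟨|c₁| * C1 + |c₂| * C2 + |c₃| * C3 + |c₄| * C4 + C5 + 1, by positivity, fun n hNn => ?_⟩
  have hn : 0 < n := by omega
  have hn0 : (0:ℝ) < n := by positivity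
  have hlin : ∀ m : ℕ, 0 < m → trapezoidal_error F₁ (2 * m) (-1) 1 =
      c₁ * trapezoidal_error (fun x => (1 - x) ^ ((1:ℝ)/2)) (2 * m) (-1) 1
      + c₂ * trapezoidal_error (fun x => (1 - x) ^ ((3:ℝ)/2)) (2 * m) (-1) 1
      + c₃ * trapezoidal_error (fun x => (1 - x) ^ ((5:ℝ)/2)) (2 * m) (-1) 1
      + c₄ * trapezoidal_error (fun x => (1 - x) ^ ((7:ℝ)/2)) (2 * m) (-1) 1
      + trapezoidal_error Fb (2 * m) (-1) 1 := by
    intro m hm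
    have hc : ∀ (c α : ℝ), 0 ≤ α → Continuous (fun x : ℝ => c * (1 - x) ^ α) := fun c α hα =>
      continuous_const.mul ((continuous_const.sub continuous_id).rpow_const (fun _ => Or.inr hα))
    have k1 := hc c₁ (1/2) (by norm_num)
    have k2 := hc c₂ (3/2) (by norm_num)
    have k3 := hc c₃ (5/2) (by norm_num)
    have k4 := hc c₄ (7/2) (by norm_num)
    have k12 : Continuous (fun x : ℝ => c₁ * (1 - x) ^ ((1:ℝ)/2) + c₂ * (1 - x) ^ ((3:ℝ)/2)) :=
      k1.add k2
    have k123 : Continuous (fun x : ℝ => c₁ * (1 - x) ^ ((1:ℝ)/2) + c₂ * (1 - x) ^ ((3:ℝ)/2)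
      + c₃ * (1 - x) ^ ((5:ℝ)/2)) := k12.add k3
    have k1234 : Continuous (fun x : ℝ => c₁ * (1 - x) ^ ((1:ℝ)/2) + c₂ * (1 - x) ^ ((3:ℝ)/2)
      + c₃ * (1 - x) ^ ((5:ℝ)/2) + c₄ * (1 - x) ^ ((7:ℝ)/2)) := k123.add k4
    have hfi : IntervalIntegrable Fb volume (-1) 1 :=
      hFb.continuousOn.intervalIntegrable_of_Icc (by norm_num)
    rw [← te_const_mul _ c₁, ← te_const_mul _ c₂, ← te_const_mul _ c₃, ← te_const_mul _ c₄,
      ← te_add _ (k1.intervalIntegrable _ _) (k2.intervalIntegrable _ _),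
      ← te_add _ (k12.intervalIntegrable _ _) (k3.intervalIntegrable _ _),
      ← te_add _ (k123.intervalIntegrable _ _) (k4.intervalIntegrable _ _),
      ← te_add _ (k1234.intervalIntegrable _ _) hfi]
    have hm' : (0:ℝ) < m := by positivity
    simp only [trapezoidal_error, trapezoidal_integral]
    rw [hrep (-1) (by norm_num), hrep 1 (by norm_num)]
    congr 1
    · congr 2
      apply Finset.sum_congr rfl
      intro k hk
      rw [Finset.mem_range] at hk
      apply hrep
      have hk' : (k:ℝ) + 1 ≤ 2 * m := by
        have : k + 1 ≤ 2 * m := by omega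
        exact_mod_cast this
      push_cast
      constructor
      · have : 0 ≤ ((k:ℝ) + 1) * (1 - -1) / (2 * m) := by norm_num; positivity
        linarith
      · have : ((k:ℝ) + 1) * (1 - -1) / (2 * m) ≤ 2 := by
          rw [div_le_iff₀ (by positivity)]; linarith
        linarith
    · apply intervalIntegral.integral_congr
      intro x hx
      rw [uIcc_of_le (by norm_num)] at hx
      exact hrep x hx
  have s1 := te_sum_form F₁ (n + 1) (by omega)
  push_cast at s1
  rw [s1, te_sum_form F₁ n hn, hlin n hn, hlin (n + 1) (by omega)]
  specialize h1 n hn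
  specialize h2 n hn
  specialize h3 n hn
  specialize h4 n hn
  specialize h5 n hn
  have m : ∀ (c C d : ℝ), |d| ≤ C / (n:ℝ) ^ ((1:ℝ)/2) →
      |c * d| ≤ |c| * C / (n:ℝ) ^ ((1:ℝ)/2) := by
    intro c C d h
    rw [abs_mul, mul_div_assoc]
    gcongr
  have g1 := m c₁ _ _ h1
  have g2 := m c₂ _ _ h2
  have g3 := m c₃ _ _ h3
  have g4 := m c₄ _ _ h4
  have g5 : 0 ≤ 1 / (n:ℝ) ^ ((1:ℝ)/2) := by positivity
  simp only [add_div]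
  rw [abs_le] at *
  constructor
  · linarith [g1.1, g1.2, g2.1, g2.2, g3.1, g3.2, g4.1, g4.2, h5.1, h5.2]
  · linarith [g1.1, g1.2, g2.1, g2.2, g3.1, g3.2, g4.1, g4.2, h5.1, h5.2]
end
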